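/- arXiv:math/0007204 — 2 statements merged into one kernel-verified Lean document; each statement's English description precedes it below -/
import Mathlib

section
/- Let Λ be an infinite, finitely generated, discrete subgroup of SO(n,1) or SU(n,1) for some n ≥ 2. Suppose that every cocycle of Λ with values in its left regular representation on ℓ²(Λ) is a coboundary, i.e. H¹(Λ, ℓ²(Λ)) = 0. Then the Poincaré series of Λ diverges at s = 2: the family (D(λ)^{−2})_{λ∈Λ} is not summable. In particular δ(Λ) ≥ 2, and if δ(Λ) = 2 then Λ is of divergence type. (By a theorem of Bekka–Valette, the hypothesis H¹(Λ, ℓ²(Λ)) = 0 holds for every finitely generated nonamenable group whose first ℓ²-Betti number vanishes, so this contains Theorem 1.5 of the paper.) -/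
noncomputable section


/-- `𝕜` is "the real case" (i.e. `𝕜 = ℝ`, as opposed to `𝕜 = ℂ`): an `RCLike` field
is real iff its imaginary unit vanishes. -/
def isRealCase (𝕜 : Type*) [RCLike 𝕜] : Prop := (RCLike.I : 𝕜) = 0

open scoped Classical in
/-- `δ(G)`: `n - 1` for `G = SO(n,1)` and `2n` for `G = SU(n,1)`. -/
def deltaG (𝕜 : Type*) [RCLike 𝕜] (n : ℕ) : ℝ :=
  if isRealCase 𝕜 then (n : ℝ) - 1 else 2 * (n : ℝ)

/-- The matrix of the quadratic/Hermitian form `x₁ x̄₁ + ⋯ + xₙ x̄ₙ − xₙ₊₁ x̄ₙ₊₁`. -/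
def formJ (n : ℕ) (𝕜 : Type*) [RCLike 𝕜] : Matrix (Fin (n + 1)) (Fin (n + 1)) 𝕜 :=
  Matrix.diagonal fun i => if (i : ℕ) = n then -1 else 1

-- `SO(n,1)` (for `𝕜 = ℝ`) resp. `SU(n,1)` (for `𝕜 = ℂ`): the group of
-- `(n+1)×(n+1)` matrices of determinant 1 preserving the standard form of signature `(n,1)`.
open Matrix in
def lorentzGroup (n : ℕ) (𝕜 : Type*) [RCLike 𝕜] :
    Subgroup (Matrix (Fin (n + 1)) (Fin (n + 1)) 𝕜)ˣ where
  carrier := {g | ((g : Matrix (Fin (n + 1)) (Fin (n + 1)) 𝕜)).det = 1 ∧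
    (g : Matrix (Fin (n + 1)) (Fin (n + 1)) 𝕜)ᴴ * formJ n 𝕜 *
      (g : Matrix (Fin (n + 1)) (Fin (n + 1)) 𝕜) = formJ n 𝕜}
  one_mem' := by
    constructor
    · simp
    · simp
  mul_mem' := by
    rintro a b ⟨ha1, ha2⟩ ⟨hb1, hb2⟩
    constructor
    · rw [Units.val_mul, Matrix.det_mul, ha1, hb1, one_mul]
    · rw [Units.val_mul, Matrix.conjTranspose_mul]
      calc (↑b : Matrix (Fin (n + 1)) (Fin (n + 1)) 𝕜)ᴴ * (↑a : Matrix (Fin (n + 1)) (Fin (n + 1)) 𝕜)ᴴ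
            * formJ n 𝕜 * ((↑a : Matrix (Fin (n + 1)) (Fin (n + 1)) 𝕜) * ↑b)
          = (↑b : Matrix (Fin (n + 1)) (Fin (n + 1)) 𝕜)ᴴ *
              ((↑a : Matrix (Fin (n + 1)) (Fin (n + 1)) 𝕜)ᴴ * formJ n 𝕜 * ↑a) * ↑b := by
            simp only [Matrix.mul_assoc]
        _ = (↑b : Matrix (Fin (n + 1)) (Fin (n + 1)) 𝕜)ᴴ * formJ n 𝕜 * ↑b := by rw [ha2]
        _ = formJ n 𝕜 := hb2
  inv_mem' := by
    rintro a ⟨ha1, ha2⟩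
    have hmul : (↑a : Matrix (Fin (n + 1)) (Fin (n + 1)) 𝕜) *
        (↑a⁻¹ : Matrix (Fin (n + 1)) (Fin (n + 1)) 𝕜) = 1 := by
      rw [← Units.val_mul, mul_inv_cancel, Units.val_one]
    constructor
    · have h := congrArg Matrix.det hmul
      rw [Matrix.det_mul, ha1, one_mul, Matrix.det_one] at h
      exact h
    · calc (↑a⁻¹ : Matrix (Fin (n + 1)) (Fin (n + 1)) 𝕜)ᴴ * formJ n 𝕜 *
            (↑a⁻¹ : Matrix (Fin (n + 1)) (Fin (n + 1)) 𝕜)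
          = (↑a⁻¹ : Matrix (Fin (n + 1)) (Fin (n + 1)) 𝕜)ᴴ *
              ((↑a : Matrix (Fin (n + 1)) (Fin (n + 1)) 𝕜)ᴴ * formJ n 𝕜 * ↑a) * ↑a⁻¹ := by
            rw [ha2]
        _ = ((↑a : Matrix (Fin (n + 1)) (Fin (n + 1)) 𝕜) * ↑a⁻¹)ᴴ * formJ n 𝕜 *
              ((↑a : Matrix (Fin (n + 1)) (Fin (n + 1)) 𝕜) * ↑a⁻¹) := by
            rw [Matrix.conjTranspose_mul]
            simp only [Matrix.mul_assoc]
        _ = formJ n 𝕜 := by rw [hmul]; simp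

/-- `D(g)`: the modulus of the `(n+1, n+1)` entry of `g`. -/
def Dent {n : ℕ} {𝕜 : Type*} [RCLike 𝕜] (g : ↥(lorentzGroup n 𝕜)) : ℝ :=
  ‖((g : (Matrix (Fin (n + 1)) (Fin (n + 1)) 𝕜)ˣ) : Matrix (Fin (n + 1)) (Fin (n + 1)) 𝕜)
    (Fin.last n) (Fin.last n)‖

/-- The critical exponent of a set of elements of `SO(n,1)`/`SU(n,1)`:
`inf {s ≥ 0 | Σ_{γ ∈ S} D(γ)^{-s} < ∞}`. -/
def critExpSet {n : ℕ} {𝕜 : Type*} [RCLike 𝕜] (S : Set ↥(lorentzGroup n 𝕜)) : ℝ :=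
  sInf {s : ℝ | 0 ≤ s ∧ Summable fun γ : S => Dent (γ : ↥(lorentzGroup n 𝕜)) ^ (-s)}

/-- The critical exponent of a subgroup. -/
def critExp {n : ℕ} {𝕜 : Type*} [RCLike 𝕜] (Λ : Subgroup ↥(lorentzGroup n 𝕜)) : ℝ :=
  critExpSet (Λ : Set ↥(lorentzGroup n 𝕜))

/-- The Borel σ-algebra on `SO(n,1)`/`SU(n,1)` (with its matrix topology). -/
instance (n : ℕ) (𝕜 : Type*) [RCLike 𝕜] : MeasurableSpace ↥(lorentzGroup n 𝕜) := borel _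

instance (n : ℕ) (𝕜 : Type*) [RCLike 𝕜] : BorelSpace ↥(lorentzGroup n 𝕜) := ⟨rfl⟩

open scoped ComplexConjugate

/-- The sesquilinear form of signature `(n,1)`. -/
def Bf {n : ℕ} {𝕜 : Type*} [RCLike 𝕜] (y z : Fin (n + 1) → 𝕜) : 𝕜 :=
  ∑ i : Fin n, conj (y i.castSucc) * z i.castSucc - conj (y (Fin.last n)) * z (Fin.last n)

/-- The underlying matrix. -/
def lmt {n : ℕ} {𝕜 : Type*} [RCLike 𝕜] (g : ↥(lorentzGroup n 𝕜)) :
    Matrix (Fin (n + 1)) (Fin (n + 1)) 𝕜 :=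
  ((g : (Matrix (Fin (n + 1)) (Fin (n + 1)) 𝕜)ˣ) : Matrix (Fin (n + 1)) (Fin (n + 1)) 𝕜)

/-- The last column. -/
def col {n : ℕ} {𝕜 : Type*} [RCLike 𝕜] (g : ↥(lorentzGroup n 𝕜)) : Fin (n + 1) → 𝕜 :=
  fun i => lmt g i (Fin.last n)

section basic
variable {n : ℕ} {𝕜 : Type*} [RCLike 𝕜]

lemma Dent_eq (g : ↥(lorentzGroup n 𝕜)) : Dent g = ‖col g (Fin.last n)‖ := rfl

lemma lmt_mul (g h : ↥(lorentzGroup n 𝕜)) : lmt (g * h) = lmt g * lmt h := by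
  simp [lmt]

lemma lmt_one : lmt (1 : ↥(lorentzGroup n 𝕜)) = 1 := by
  simp [lmt]

lemma lmt_form (g : ↥(lorentzGroup n 𝕜)) :
    (lmt g).conjTranspose * formJ n 𝕜 * lmt g = formJ n 𝕜 := g.2.2

lemma formJ_sq : formJ n 𝕜 * formJ n 𝕜 = 1 := by
  unfold formJ
  rw [Matrix.diagonal_mul_diagonal, ← Matrix.diagonal_one]
  congr 1
  ext i
  split_ifs <;> simp

lemma lmt_inv (g : ↥(lorentzGroup n 𝕜)) :
    lmt g⁻¹ = formJ n 𝕜 * (lmt g).conjTranspose * formJ n 𝕜 := by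
  have h1 : formJ n 𝕜 * (lmt g).conjTranspose * formJ n 𝕜 * lmt g = 1 := by
    rw [Matrix.mul_assoc, Matrix.mul_assoc, ← Matrix.mul_assoc (lmt g).conjTranspose,
      lmt_form, formJ_sq]
  have h2 : lmt g * lmt g⁻¹ = 1 := by rw [← lmt_mul, mul_inv_cancel, lmt_one]
  calc lmt g⁻¹ = (formJ n 𝕜 * (lmt g).conjTranspose * formJ n 𝕜 * lmt g) * lmt g⁻¹ := by
        rw [h1, Matrix.one_mul]
    _ = _ := by rw [Matrix.mul_assoc _ (lmt g), h2, Matrix.mul_one]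

lemma lmt_inv_last (g : ↥(lorentzGroup n 𝕜)) (j : Fin (n + 1)) :
    ‖lmt g⁻¹ j (Fin.last n)‖ = ‖lmt g (Fin.last n) j‖ := by
  rw [lmt_inv]
  unfold formJ
  rw [Matrix.mul_diagonal, Matrix.diagonal_mul, Matrix.conjTranspose_apply]
  split_ifs <;> simp

lemma Dent_inv (g : ↥(lorentzGroup n 𝕜)) : Dent g⁻¹ = Dent g :=
  lmt_inv_last g (Fin.last n)

lemma Bf_eq (y z : Fin (n + 1) → 𝕜) :
    Bf y z = dotProduct (star y) (Matrix.mulVec (formJ n 𝕜) z) := by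
  unfold formJ
  simp only [dotProduct, Matrix.mulVec_diagonal, Fin.sum_univ_castSucc, Bf]
  have : ∀ i : Fin n, (i : ℕ) ≠ n := fun i => i.2.ne
  simp [this, sub_eq_add_neg]

lemma Bf_mulVec (g : ↥(lorentzGroup n 𝕜)) (y z : Fin (n + 1) → 𝕜) :
    Bf (Matrix.mulVec (lmt g) y) (Matrix.mulVec (lmt g) z) = Bf y z := by
  rw [Bf_eq, Bf_eq, Matrix.star_mulVec, ← Matrix.dotProduct_mulVec, Matrix.mulVec_mulVec,
    Matrix.mulVec_mulVec, lmt_form]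

lemma col_mul (g h : ↥(lorentzGroup n 𝕜)) : col (g * h) = Matrix.mulVec (lmt g) (col h) := by
  ext i
  simp [col, lmt_mul, Matrix.mul_apply, Matrix.mulVec, dotProduct]

lemma col_one_last : col (1 : ↥(lorentzGroup n 𝕜)) (Fin.last n) = 1 := by
  simp [col, lmt_one]

lemma col_one_cs (i : Fin n) : col (1 : ↥(lorentzGroup n 𝕜)) i.castSucc = 0 := by
  simp [col, lmt_one, (Fin.castSucc_lt_last i).ne]

lemma Bf_one (z : Fin (n + 1) → 𝕜) :
    Bf (col (1 : ↥(lorentzGroup n 𝕜))) z = - z (Fin.last n) := by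
  simp [Bf, col_one_last, col_one_cs]

lemma Bf_col (g : ↥(lorentzGroup n 𝕜)) : Bf (col g) (col g) = -1 := by
  have := Bf_mulVec g (col 1) (col 1)
  rwa [← col_mul, mul_one, Bf_one, col_one_last] at this

lemma Bf_self (y : Fin (n + 1) → 𝕜) :
    RCLike.re (Bf y y) = ∑ i : Fin n, ‖y i.castSucc‖ ^ 2 - ‖y (Fin.last n)‖ ^ 2 := by
  simp only [Bf, RCLike.conj_mul]
  rw [map_sub, map_sum]
  norm_cast

lemma col_sum (g : ↥(lorentzGroup n 𝕜)) :
    ∑ i : Fin n, ‖col g i.castSucc‖ ^ 2 = Dent g ^ 2 - 1 := by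
  have h := Bf_self (col g)
  rw [Bf_col, ← Dent_eq] at h
  simp at h
  linarith

lemma Dent_ge (g : ↥(lorentzGroup n 𝕜)) : 1 ≤ Dent g := by
  have h := col_sum g
  have h1 : 0 ≤ ∑ i : Fin n, ‖col g i.castSucc‖ ^ 2 := Finset.sum_nonneg fun _ _ => by positivity
  have h2 : 0 ≤ Dent g := norm_nonneg _
  nlinarith

lemma col_le (g : ↥(lorentzGroup n 𝕜)) (i : Fin (n + 1)) : ‖col g i‖ ≤ Dent g := by
  have h2 : 0 ≤ Dent g := norm_nonneg _
  induction i using Fin.lastCases with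
  | last => exact le_rfl
  | cast i =>
    have h := col_sum g
    have h1 := Finset.single_le_sum (f := fun i : Fin n => ‖col g i.castSucc‖ ^ 2)
      (fun _ _ => by positivity) (Finset.mem_univ i)
    exact abs_le_of_sq_le_sq' (by linarith) h2 |>.2

lemma row_le (g : ↥(lorentzGroup n 𝕜)) (j : Fin (n + 1)) :
    ‖lmt g (Fin.last n) j‖ ≤ Dent g := by
  rw [← lmt_inv_last, ← Dent_inv]
  exact col_le _ _

lemma Dent_mul_le (g h : ↥(lorentzGroup n 𝕜)) : Dent (g * h) ≤ (n + 1) * Dent g * Dent h := by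
  rw [Dent_eq, col_mul]
  calc ‖Matrix.mulVec (lmt g) (col h) (Fin.last n)‖
      ≤ ∑ j, ‖lmt g (Fin.last n) j * col h j‖ := by
        simp only [Matrix.mulVec, dotProduct]
        exact norm_sum_le _ _
    _ ≤ ∑ j : Fin (n + 1), Dent g * Dent h := by
        gcongr with j
        rw [norm_mul]
        exact mul_le_mul (row_le g j) (col_le h j) (norm_nonneg _) (norm_nonneg _)
    _ = _ := by simp; ring

lemma Bf_diff (y z : Fin (n + 1) → 𝕜) (s t : 𝕜)
    (h : s * y (Fin.last n) = t * z (Fin.last n)) :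
    ∑ i : Fin n, ‖s * y i.castSucc - t * z i.castSucc‖ ^ 2 ≤
      ‖s‖ ^ 2 * RCLike.re (Bf y y) + ‖t‖ ^ 2 * RCLike.re (Bf z z)
        + 2 * (‖s‖ * ‖t‖ * ‖Bf y z‖) := by
  have e1 := Bf_self (fun i => s * y i - t * z i)
  have key : RCLike.re (Bf (fun i => s * y i - t * z i) (fun i => s * y i - t * z i)) =
      ‖s‖ ^ 2 * RCLike.re (Bf y y) + ‖t‖ ^ 2 * RCLike.re (Bf z z)
        - 2 * RCLike.re (conj s * t * Bf y z) := by
    have hs : conj (Bf y z) = Bf z y := by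
      simp [Bf, mul_comm]
    have e : Bf (fun i => s * y i - t * z i) (fun i => s * y i - t * z i) =
        conj s * s * Bf y y + conj t * t * Bf z z - conj s * t * Bf y z
          - conj (conj s * t * Bf y z) := by
      simp only [map_mul, hs, RCLike.conj_conj]
      simp only [Bf, mul_sub, Finset.mul_sum]
      have : ∑ i : Fin n, conj (s * y i.castSucc - t * z i.castSucc) *
          (s * y i.castSucc - t * z i.castSucc) =
          ∑ i : Fin n, conj s * s * (conj (y i.castSucc) * y i.castSucc)
          + ∑ i : Fin n, conj t * t * (conj (z i.castSucc) * z i.castSucc)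
          - ∑ i : Fin n, conj s * t * (conj (y i.castSucc) * z i.castSucc)
          - ∑ i : Fin n, s * conj t * (conj (z i.castSucc) * y i.castSucc) := by
        rw [← Finset.sum_add_distrib, ← Finset.sum_sub_distrib, ← Finset.sum_sub_distrib]
        refine Finset.sum_congr rfl fun i _ => ?_
        simp only [map_sub, map_mul]
        ring
      simp only [mul_sub] at this
      rw [this]
      simp only [map_sub, map_mul]
      ring
    rw [e, map_sub, map_sub, map_add, RCLike.conj_re, RCLike.conj_mul, RCLike.conj_mul]
    have q : ∀ (r : ℝ) (w : 𝕜), RCLike.re ((r : 𝕜) ^ 2 * w) = r ^ 2 * RCLike.re w := by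
      intro r w
      rw [← RCLike.ofReal_pow, RCLike.re_ofReal_mul]
    rw [q, q]
    ring
  rw [key] at e1
  simp only [h, sub_self, norm_zero] at e1
  have h3 : |RCLike.re (conj s * t * Bf y z)| ≤ ‖s‖ * ‖t‖ * ‖Bf y z‖ := by
    refine (RCLike.abs_re_le_norm _).trans ?_
    simp
  have := (abs_le.1 h3).1
  linarith

/-- Visual size of bounded sets at a point of the orbit. -/
lemma visual (g γ : ↥(lorentzGroup n 𝕜)) (i : Fin n) :
    ‖col (g * γ) i.castSucc / col (g * γ) (Fin.last n)
      - col g i.castSucc / col g (Fin.last n)‖ ^ 2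
      ≤ (2 * (n + 1) * Dent γ ^ 2) * Dent g ^ (-(2 : ℝ)) := by
  have hz : col (g * γ) (Fin.last n) ≠ 0 := by
    have := Dent_ge (g * γ); rw [Dent_eq] at this
    exact norm_pos_iff.1 (by linarith)
  have hy : col g (Fin.last n) ≠ 0 := by
    have := Dent_ge g; rw [Dent_eq] at this
    exact norm_pos_iff.1 (by linarith)
  have h := Bf_diff (col (g * γ)) (col g) (col (g * γ) (Fin.last n))⁻¹ (col g (Fin.last n))⁻¹
    (by rw [inv_mul_cancel₀ hz, inv_mul_cancel₀ hy])
  have hB : ‖Bf (col (g * γ)) (col g)‖ = Dent γ := by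
    have := Bf_mulVec g (col γ) (col 1)
    rw [← col_mul, ← col_mul, mul_one] at this
    rw [this, Bf]
    simp [col_one_last, col_one_cs, Dent_eq]
  rw [Bf_col, Bf_col, hB] at h
  have h1 := Finset.single_le_sum (f := fun i : Fin n =>
      ‖(col (g * γ) (Fin.last n))⁻¹ * col (g * γ) i.castSucc
        - (col g (Fin.last n))⁻¹ * col g i.castSucc‖ ^ 2)
      (fun _ _ => by positivity) (Finset.mem_univ i)
  simp only [map_neg, RCLike.one_re, norm_inv, ← Dent_eq] at h h1
  rw [div_eq_inv_mul, div_eq_inv_mul]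
  have hg := Dent_ge g
  have hgγ := Dent_ge (g * γ)
  have hγ := Dent_ge γ
  have hm : Dent g ≤ (n + 1) * Dent (g * γ) * Dent γ := by
    have := Dent_mul_le (g * γ) γ⁻¹
    rwa [mul_inv_cancel_right, Dent_inv] at this
  have h2 : (Dent (g * γ))⁻¹ ≤ (n + 1) * Dent γ * (Dent g)⁻¹ := by
    rw [inv_le_iff_one_le_mul₀ (by linarith)]
    have h5 : 0 ≤ (Dent g)⁻¹ := by positivity
    calc 1 = Dent g * (Dent g)⁻¹ := by rw [mul_inv_cancel₀ (by linarith)]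
      _ ≤ ((n + 1) * Dent (g * γ) * Dent γ) * (Dent g)⁻¹ := by gcongr
      _ = _ := by ring
  have h3 : Dent g ^ (-(2 : ℝ)) = (Dent g)⁻¹ * (Dent g)⁻¹ := by
    rw [Real.rpow_neg (by linarith), ← mul_inv]
    norm_num [sq]
  rw [h3]
  have h4 : (Dent (g * γ))⁻¹ * (Dent g)⁻¹ * Dent γ ≤
      ((n + 1) * Dent γ * (Dent g)⁻¹) * (Dent g)⁻¹ * Dent γ := by gcongr
  have h5 : 0 ≤ (Dent (g * γ))⁻¹ ^ 2 := by positivity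
  have h6 : 0 ≤ (Dent g)⁻¹ ^ 2 := by positivity
  nlinarith

end basic
section analysis
open Filter Topology
variable {n : ℕ} {𝕜 : Type*} [RCLike 𝕜]

/-- Vanishing of `H¹(Λ, ℓ²Λ)`. -/
def HOneVanish (G : Type*) [Group G] : Prop :=
  ∀ b : G → lp (fun _ : G => ℂ) 2,
      (∀ γ η x : G, (b (γ * η) : ∀ _ : G, ℂ) x
          = (b γ : ∀ _ : G, ℂ) x + (b η : ∀ _ : G, ℂ) (γ⁻¹ * x)) →
      ∃ f : lp (fun _ : G => ℂ) 2, ∀ γ x : G,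
        (b γ : ∀ _ : G, ℂ) x = (f : ∀ _ : G, ℂ) (γ⁻¹ * x) - (f : ∀ _ : G, ℂ) x

lemma HOneVanish.const {G : Type*} [Group G] (H : HOneVanish G) (f : G → ℂ)
    (hf : ∀ γ : G, Summable fun x => ‖f (γ⁻¹ * x) - f x‖ ^ 2) :
    ∃ k : ℂ, Summable fun x => ‖f x - k‖ ^ 2 := by
  have hm : ∀ γ : G, Memℓp (fun x => f (γ⁻¹ * x) - f x) 2 := by
    intro γ
    rw [memℓp_gen_iff (by norm_num)]
    simpa using hf γ
  obtain ⟨h, hh⟩ := H (fun γ => ⟨fun x => f (γ⁻¹ * x) - f x, hm γ⟩) (by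
    intro γ η x
    simp only [mul_inv_rev, mul_assoc]
    ring)
  refine ⟨f 1 - h 1, ?_⟩
  have e : ∀ x, f x - (f 1 - h 1) = h x := by
    intro x
    have := hh x x
    simp only [inv_mul_cancel] at this
    linear_combination -this
  simp only [e]
  have := (memℓp_gen_iff (p := 2) (by norm_num)).1 h.2
  simpa using this

lemma tendsto_of_summable_sq {ι : Type*} {f : ι → ℂ} {k : ℂ}
    (h : Summable fun x => ‖f x - k‖ ^ 2) : Tendsto f cofinite (𝓝 k) := by
  have h1 := h.tendsto_cofinite_zero
  have h2 := h1.sqrt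
  simp only [Real.sqrt_zero, Real.sqrt_sq (norm_nonneg _)] at h2
  exact tendsto_iff_norm_sub_tendsto_zero.2 h2

/-- Embedding of `𝕜` in `ℂ`. -/
def toC (z : 𝕜) : ℂ := ⟨RCLike.re z, RCLike.im z⟩

lemma toC_sub (z w : 𝕜) : toC (z - w) = toC z - toC w := by
  apply Complex.ext <;> simp [toC]

lemma norm_toC (z : 𝕜) : ‖toC z‖ = ‖z‖ := by
  rw [← sq_eq_sq₀ (norm_nonneg _) (norm_nonneg _), Complex.sq_norm, RCLike.norm_sq_eq_def]
  simp [toC, Complex.normSq_apply]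

/-- If the Poincaré series converges at `2`, the orbit converges to one boundary point. -/
lemma exists_limit (Λ : Subgroup ↥(lorentzGroup n 𝕜)) (H : HOneVanish ↥Λ)
    (hS : Summable fun γ : ↥Λ => Dent (γ : ↥(lorentzGroup n 𝕜)) ^ (-(2 : ℝ))) [Infinite ↥Λ]
    (i : Fin n) :
    ∃ c : 𝕜, Tendsto (fun x : ↥Λ => col (x : ↥(lorentzGroup n 𝕜)) i.castSucc /
      col (x : ↥(lorentzGroup n 𝕜)) (Fin.last n)) cofinite (𝓝 c) := by
  let F : ↥Λ → 𝕜 := fun x => col (x : ↥(lorentzGroup n 𝕜)) i.castSucc /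
      col (x : ↥(lorentzGroup n 𝕜)) (Fin.last n)
  obtain ⟨k, hk⟩ := H.const (fun x => toC (F x⁻¹)) (by
    intro γ
    have hS' := (hS.mul_left (2 * (n + 1) * Dent (γ : ↥(lorentzGroup n 𝕜)) ^ 2))
    refine Summable.of_nonneg_of_le (fun _ => by positivity) (fun x => ?_) hS'
    rw [← toC_sub, norm_toC]
    have := visual ((x : ↥(lorentzGroup n 𝕜))⁻¹) (γ : ↥(lorentzGroup n 𝕜)) i
    rw [Dent_inv] at this
    simpa [F] using this)
  have h1 := tendsto_of_summable_sq hk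
  have h2 : Tendsto (fun x : ↥Λ => toC (F x)) cofinite (𝓝 k) := by
    have := h1.comp (inv_injective (G := ↥Λ)).tendsto_cofinite
    simpa [Function.comp_def] using this
  have hcont : Continuous fun z : ℂ => ((z.re : 𝕜) + (z.im : 𝕜) * RCLike.I) := by
    have := RCLike.continuous_ofReal (K := 𝕜)
    fun_prop
  refine ⟨_, ((hcont.tendsto k).comp h2).congr fun x => ?_⟩
  simp [toC, F]

/-- Data of a common limit point fixed by `Λ`. -/
lemma limit_data (Λ : Subgroup ↥(lorentzGroup n 𝕜)) (H : HOneVanish ↥Λ)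
    (hS : Summable fun γ : ↥Λ => Dent (γ : ↥(lorentzGroup n 𝕜)) ^ (-(2 : ℝ))) [Infinite ↥Λ] :
    Tendsto (fun x : ↥Λ => Dent (x : ↥(lorentzGroup n 𝕜))) cofinite atTop ∧
    ∃ c : Fin (n + 1) → 𝕜, c (Fin.last n) = 1 ∧ Bf c c = 0 ∧
      ∀ γ : ↥Λ, Matrix.mulVec (lmt (γ : ↥(lorentzGroup n 𝕜))) c =
        (Matrix.mulVec (lmt (γ : ↥(lorentzGroup n 𝕜))) c (Fin.last n)) • c ∧
        ‖Matrix.mulVec (lmt (γ : ↥(lorentzGroup n 𝕜))) c (Fin.last n)‖ = 1 := by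
  have hD : Tendsto (fun x : ↥Λ => Dent (x : ↥(lorentzGroup n 𝕜))) cofinite atTop := by
    have h0 := hS.tendsto_cofinite_zero
    have h1 : Tendsto (fun x : ↥Λ => Dent (x : ↥(lorentzGroup n 𝕜)) ^ (-(2 : ℝ))) cofinite
        (𝓝[>] 0) := tendsto_nhdsWithin_iff.2 ⟨h0, Eventually.of_forall fun x =>
          Real.rpow_pos_of_pos (by linarith [Dent_ge (x : ↥(lorentzGroup n 𝕜))]) _⟩
    have h2 := Real.tendsto_sqrt_atTop.comp h1.inv_tendsto_nhdsGT_zero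
    refine h2.congr fun x => ?_
    have := Dent_ge (x : ↥(lorentzGroup n 𝕜))
    simp only [Function.comp, Pi.inv_apply]
    rw [Real.rpow_neg (by linarith), inv_inv]
    norm_num
    rw [Real.sqrt_sq (by linarith)]
  refine ⟨hD, ?_⟩
  have hl : ∀ x : ↥(lorentzGroup n 𝕜), col x (Fin.last n) ≠ 0 := by
    intro x
    have := Dent_ge x; rw [Dent_eq] at this
    exact norm_pos_iff.1 (by linarith)
  choose c0 hc0 using exists_limit Λ H hS
  let c : Fin (n + 1) → 𝕜 := Fin.lastCases 1 c0
  have hcl : c (Fin.last n) = 1 := by simp [c]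
  let P : ↥Λ → Fin (n + 1) → 𝕜 := fun x i => col (x : ↥(lorentzGroup n 𝕜)) i /
      col (x : ↥(lorentzGroup n 𝕜)) (Fin.last n)
  have hP : Tendsto P cofinite (𝓝 c) := by
    rw [tendsto_pi_nhds]
    intro i
    induction i using Fin.lastCases with
    | last =>
      rw [hcl]
      refine tendsto_const_nhds.congr fun x => ?_
      simp [P, hl]
    | cast i => simpa [c, P] using hc0 i
  have hB : ∀ x, Bf (P x) (P x) =
      -((((Dent (x : ↥(lorentzGroup n 𝕜)) ^ 2)⁻¹ : ℝ)) : 𝕜) := by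
    intro x
    have e := Bf_col (x : ↥(lorentzGroup n 𝕜))
    have q : Bf (P x) (P x) = (Bf (col (x : ↥(lorentzGroup n 𝕜))) (col (x : ↥(lorentzGroup n 𝕜))))
        * (conj (col (x : ↥(lorentzGroup n 𝕜)) (Fin.last n)) *
          col (x : ↥(lorentzGroup n 𝕜)) (Fin.last n))⁻¹ := by
      simp only [Bf, P, sub_mul, Finset.sum_mul]
      congr 1
      · refine Finset.sum_congr rfl fun i _ => ?_
        simp only [div_eq_mul_inv, mul_inv, map_mul, map_inv₀]
        ring
      · simp only [div_eq_mul_inv, mul_inv, map_mul, map_inv₀]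
        ring
    rw [q, e, RCLike.conj_mul, ← Dent_eq]
    push_cast
    ring
  have hcB : Continuous fun y : Fin (n + 1) → 𝕜 => Bf y y := by
    unfold Bf
    have := RCLike.continuous_conj (K := 𝕜)
    fun_prop
  have hBc : Bf c c = 0 := by
    have h1 := (hcB.tendsto c).comp hP
    have h2 : Tendsto (fun x : ↥Λ => -((((Dent (x : ↥(lorentzGroup n 𝕜)) ^ 2)⁻¹ : ℝ)) : 𝕜))
        cofinite (𝓝 (-((0 : ℝ) : 𝕜))) :=
      ((RCLike.continuous_ofReal (K := 𝕜)).tendsto 0 |>.comp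
        (((tendsto_pow_atTop two_ne_zero).comp hD).inv_tendsto_atTop)).neg
    have h3 := tendsto_nhds_unique (h1.congr hB) h2
    simpa using h3
  have hmul : ∀ γ : ↥Λ, Tendsto (fun x : ↥Λ => γ * x) cofinite cofinite :=
    fun γ => (mul_right_injective γ).tendsto_cofinite
  have hPm : ∀ γ x : ↥Λ, Matrix.mulVec (lmt (γ : ↥(lorentzGroup n 𝕜))) (P x) =
      (Matrix.mulVec (lmt (γ : ↥(lorentzGroup n 𝕜))) (P x) (Fin.last n)) • P (γ * x) := by
    intro γ x
    have e : P x = (col (x : ↥(lorentzGroup n 𝕜)) (Fin.last n))⁻¹ • col (x : ↥(lorentzGroup n 𝕜)) := by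
      ext i; simp [P, div_eq_inv_mul]
    have hne := hl ((γ : ↥(lorentzGroup n 𝕜)) * x)
    rw [e, Matrix.mulVec_smul, ← col_mul]
    ext i
    simp only [Pi.smul_apply, smul_eq_mul, P, Subgroup.coe_mul]
    field_simp
  have hT : ∀ γ : ↥Λ, Tendsto (fun x => Matrix.mulVec (lmt (γ : ↥(lorentzGroup n 𝕜))) (P x))
      cofinite (𝓝 (Matrix.mulVec (lmt (γ : ↥(lorentzGroup n 𝕜))) c)) := by
    intro γ
    have : Continuous fun y : Fin (n + 1) → 𝕜 =>
      Matrix.mulVec (lmt (γ : ↥(lorentzGroup n 𝕜))) y := by fun_prop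
    exact (this.tendsto c).comp hP
  have hfix : ∀ γ : ↥Λ, Matrix.mulVec (lmt (γ : ↥(lorentzGroup n 𝕜))) c =
        (Matrix.mulVec (lmt (γ : ↥(lorentzGroup n 𝕜))) c (Fin.last n)) • c := by
    intro γ
    have h1 := ((tendsto_pi_nhds.1 (hT γ)) (Fin.last n)).smul (hP.comp (hmul γ))
    exact tendsto_nhds_unique (hT γ) (h1.congr fun x => (hPm γ x).symm)
  let χ : ↥Λ → 𝕜 := fun γ => Matrix.mulVec (lmt (γ : ↥(lorentzGroup n 𝕜))) c (Fin.last n)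
  have hχm : ∀ γ η, χ (γ * η) = χ γ * χ η := by
    intro γ η
    simp only [χ]
    rw [Subgroup.coe_mul, lmt_mul, ← Matrix.mulVec_mulVec, hfix η, Matrix.mulVec_smul]
    simp [hcl, mul_comm]
  have hχ1 : χ 1 = 1 := by simp [χ, lmt_one, hcl]
  have hχp : ∀ γ k, χ (γ ^ k) = χ γ ^ k := by
    intro γ k
    induction k with
    | zero => simp [hχ1]
    | succ k ih => rw [pow_succ, hχm, ih, pow_succ]
  have hratio : ∀ γ : ↥Λ, Tendsto (fun x : ↥Λ => Dent ((γ * x : ↥Λ) : ↥(lorentzGroup n 𝕜)) /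
      Dent (x : ↥(lorentzGroup n 𝕜))) cofinite (𝓝 ‖χ γ‖) := by
    intro γ
    refine ((tendsto_pi_nhds.1 (hT γ)) (Fin.last n)).norm.congr fun x => ?_
    have e : P x = (col (x : ↥(lorentzGroup n 𝕜)) (Fin.last n))⁻¹ • col (x : ↥(lorentzGroup n 𝕜)) := by
      ext i; simp [P, div_eq_inv_mul]
    rw [e, Matrix.mulVec_smul, ← col_mul]
    simp [Dent_eq, div_eq_inv_mul]
  have hge : ∀ γ : ↥Λ, 1 ≤ ‖χ γ‖ := by
    intro γ
    by_contra! hlt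
    have hpos : 0 < ‖χ γ‖ := by
      rw [norm_pos_iff]
      intro h0
      have := hχm γ γ⁻¹
      rw [mul_inv_cancel, hχ1, h0, zero_mul] at this
      exact one_ne_zero this
    have hinj : Function.Injective fun k : ℕ => γ ^ k := by
      intro a b hab
      have h1 : ‖χ γ‖ ^ a = ‖χ γ‖ ^ b := by
        rw [← norm_pow, ← norm_pow, ← hχp, ← hχp]
        exact congrArg (fun g => ‖χ g‖) hab
      exact pow_right_injective₀ hpos hlt.ne h1
    have hev : ∀ᶠ x : ↥Λ in cofinite, Dent ((γ * x : ↥Λ) : ↥(lorentzGroup n 𝕜)) ≤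
        Dent (x : ↥(lorentzGroup n 𝕜)) := by
      filter_upwards [(hratio γ).eventually_lt_const hlt] with x hx
      have := Dent_ge (x : ↥(lorentzGroup n 𝕜))
      rw [div_lt_one (by linarith)] at hx
      exact hx.le
    have ht : Tendsto (fun k : ℕ => γ ^ k) atTop cofinite := by
      rw [← Nat.cofinite_eq_atTop]; exact hinj.tendsto_cofinite
    obtain ⟨K, hK⟩ := eventually_atTop.1 (ht.eventually hev)
    have hbd : ∀ k, K ≤ k → Dent ((γ ^ k : ↥Λ) : ↥(lorentzGroup n 𝕜)) ≤
        Dent ((γ ^ K : ↥Λ) : ↥(lorentzGroup n 𝕜)) := by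
      intro k hk
      induction k, hk using Nat.le_induction with
      | base => exact le_rfl
      | succ k hk ih =>
        have := hK k hk
        rw [← pow_succ'] at this
        exact this.trans ih
    have h5 := (hD.comp ht).eventually_gt_atTop (Dent ((γ ^ K : ↥Λ) : ↥(lorentzGroup n 𝕜)))
    obtain ⟨k, hk1, hk2⟩ := (h5.and (eventually_ge_atTop K)).exists
    exact absurd (hbd k hk2) (not_le.2 hk1)
  refine ⟨c, hcl, hBc, fun γ => ⟨hfix γ, le_antisymm ?_ (hge γ)⟩⟩
  have h1 := hge γ⁻¹
  have h2 : ‖χ γ‖ * ‖χ γ⁻¹‖ = 1 := by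
    rw [← norm_mul, ← hχm, mul_inv_cancel, hχ1, norm_one]
  change ‖χ γ‖ ≤ 1
  nlinarith [norm_nonneg (χ γ)]

end analysis
section parabolic
open Filter Topology
variable {n : ℕ} {𝕜 : Type*} [RCLike 𝕜]

lemma log_bound {a b C K : ℝ} (ha : 1 ≤ a) (hb : 1 ≤ b) (hK : 1 ≤ K) (hC : 0 ≤ C)
    (h : |a - b| ≤ C * √b) (hba : b ≤ K * a) :
    (Real.log a - Real.log b) ^ 2 ≤ (C * K) ^ 2 * b⁻¹ := by
  have hb0 : 0 < b := by linarith
  have ha0 : 0 < a := by linarith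
  have hs : √b / b = (√b)⁻¹ := by
    rw [Real.sqrt_div_self', one_div]
  have hsp : 0 ≤ (√b)⁻¹ := by positivity
  obtain ⟨h1, h2⟩ := abs_le.1 h
  have u1 : Real.log a - Real.log b ≤ C * K * (√b)⁻¹ := by
    rw [← Real.log_div ha0.ne' hb0.ne']
    calc Real.log (a / b) ≤ a / b - 1 := Real.log_le_sub_one_of_pos (by positivity)
      _ = (a - b) / b := by field_simp
      _ ≤ (C * √b) / b := by gcongr
      _ = C * 1 * (√b)⁻¹ := by rw [mul_div_assoc, hs, mul_one]
      _ ≤ _ := by gcongr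
  have u2 : Real.log b - Real.log a ≤ C * K * (√b)⁻¹ := by
    rw [← Real.log_div hb0.ne' ha0.ne']
    calc Real.log (b / a) ≤ b / a - 1 := Real.log_le_sub_one_of_pos (by positivity)
      _ = (b - a) / a := by field_simp
      _ ≤ (C * √b) / a := by gcongr; linarith
      _ ≤ (C * √b) / (b / K) := by
          gcongr
          rw [div_le_iff₀ (by linarith)]; linarith
      _ = C * K * (√b / b) := by field_simp
      _ = _ := by rw [hs]
  have : (C * K) ^ 2 * b⁻¹ = (C * K * (√b)⁻¹) ^ 2 := by
    rw [mul_pow (C * K) (√b)⁻¹, inv_pow, Real.sq_sqrt hb0.le]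
  rw [this]
  exact sq_le_sq' (by linarith) u1

lemma invsqrt_bound {a b C K : ℝ} (ha : 1 ≤ a) (hb : 1 ≤ b)
    (h : |a - b| ≤ C * √b) (hba : b ≤ K * a) :
    ((√a)⁻¹ - (√b)⁻¹) ^ 2 ≤ (C ^ 2 * K) * (b⁻¹ * b⁻¹) := by
  have hb0 : 0 < b := by linarith
  have ha0 : 0 < a := by linarith
  have hp : 0 < √a := by positivity
  have hq : 0 < √b := by positivity
  have e1 : √a ^ 2 = a := Real.sq_sqrt ha0.le
  have e2 : √b ^ 2 = b := Real.sq_sqrt hb0.le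
  have h3 : |√a - √b| ≤ C := by
    have e3 : |a - b| = |√a - √b| * (√a + √b) := by
      rw [← abs_of_pos (show 0 < √a + √b by positivity), ← abs_mul]
      congr 1
      nlinarith
    rw [e3] at h
    have : |√a - √b| * √b ≤ C * √b := by
      refine le_trans ?_ h
      gcongr
      linarith
    exact le_of_mul_le_mul_right this hq
  have e4 : ((√a)⁻¹ - (√b)⁻¹) ^ 2 = (√a - √b) ^ 2 * (a⁻¹ * b⁻¹) := by
    nth_rewrite 3 [← e1]
    nth_rewrite 3 [← e2]
    field_simp
    ring
  have h4 : (√a - √b) ^ 2 ≤ C ^ 2 := by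
    rw [← sq_abs]
    gcongr
  have h5 : a⁻¹ ≤ K * b⁻¹ := by
    rw [← div_eq_mul_inv, le_div_iff₀ hb0, inv_mul_le_iff₀ ha0]
    linarith
  rw [e4]
  calc (√a - √b) ^ 2 * (a⁻¹ * b⁻¹) ≤ C ^ 2 * ((K * b⁻¹) * b⁻¹) := by gcongr
    _ = _ := by ring

lemma rpow_neg_two {D : ℝ} (h : 1 ≤ D) : D ^ (-(2 : ℝ)) = D⁻¹ * D⁻¹ := by
  rw [Real.rpow_neg (by linarith), ← mul_inv]
  norm_num [sq]

lemma Dent_lower (γ x : ↥(lorentzGroup n 𝕜)) :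
    Dent x ≤ ((n + 1) * Dent γ) * Dent (γ * x) := by
  have := Dent_mul_le γ⁻¹ (γ * x)
  rwa [inv_mul_cancel_left, Dent_inv] at this

lemma Dent_parabolic (γ x : ↥(lorentzGroup n 𝕜)) (c : Fin (n + 1) → 𝕜)
    (hcl : c (Fin.last n) = 1) (hc : Bf c c = 0)
    (hγ : ‖Matrix.mulVec (lmt γ) c (Fin.last n)‖ = 1)
    (hx : ‖Matrix.mulVec (lmt x⁻¹) c (Fin.last n)‖ = 1) :
    |Dent (γ * x) - Dent x| ≤ ((n + 1) * Dent γ * √2) * √(Dent x) := by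
  have hB : ‖Bf (col x) c‖ = 1 := by
    have := Bf_mulVec x⁻¹ (col x) c
    rw [← col_mul, inv_mul_cancel, Bf_one] at this
    rw [← this, norm_neg, hx]
  have h := Bf_diff (col x) c 1 (col x (Fin.last n)) (by rw [hcl]; ring)
  rw [Bf_col, hc, hB, ← Dent_eq] at h
  simp only [norm_one, map_neg, RCLike.one_re, map_zero, one_mul] at h
  let e : Fin (n + 1) → 𝕜 := fun i => col x i - col x (Fin.last n) * c i
  have he : ∀ i, ‖e i‖ ≤ √2 * √(Dent x) := by
    intro i
    rw [← Real.sqrt_mul (by norm_num)]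
    apply Real.le_sqrt_of_sq_le
    have hx1 := Dent_ge x
    induction i using Fin.lastCases with
    | last => simp [e, hcl]; linarith
    | cast i =>
      have h1 := Finset.single_le_sum
        (f := fun i : Fin n => ‖col x i.castSucc - col x (Fin.last n) * c i.castSucc‖ ^ 2)
        (fun _ _ => by positivity) (Finset.mem_univ i)
      simp only [e]
      linarith
  have hcol : col (γ * x) (Fin.last n) =
      col x (Fin.last n) * Matrix.mulVec (lmt γ) c (Fin.last n)
        + Matrix.mulVec (lmt γ) e (Fin.last n) := by
    have : col x = col x (Fin.last n) • c + e := by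
      ext i; simp [e]
    rw [col_mul]
    nth_rewrite 1 [this]
    rw [Matrix.mulVec_add, Matrix.mulVec_smul]
    simp
  have h2 : ‖Matrix.mulVec (lmt γ) e (Fin.last n)‖ ≤ ((n + 1) * Dent γ * √2) * √(Dent x) := by
    simp only [Matrix.mulVec, dotProduct]
    calc ‖∑ j, lmt γ (Fin.last n) j * e j‖ ≤ ∑ j, ‖lmt γ (Fin.last n) j * e j‖ := norm_sum_le _ _
      _ ≤ ∑ j : Fin (n + 1), Dent γ * (√2 * √(Dent x)) := by
        gcongr with j
        rw [norm_mul]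
        exact mul_le_mul (row_le γ j) (he j) (norm_nonneg _) (norm_nonneg _)
      _ = _ := by simp; ring
  refine le_trans ?_ h2
  have h3 : Dent x = ‖col x (Fin.last n) * Matrix.mulVec (lmt γ) c (Fin.last n)‖ := by
    rw [norm_mul, hγ, mul_one, Dent_eq]
  rw [Dent_eq (γ * x), h3, hcol]
  refine (abs_norm_sub_norm_le _ _).trans ?_
  simp

/-- The group with sublinear distortion of `D` has nontrivial `H¹`. -/
lemma abstract_parabolic {G : Type*} [Group G] [Infinite G] (H : HOneVanish G) (D C K : G → ℝ)
    (hge : ∀ x, 1 ≤ D x) (hD : Tendsto D cofinite atTop)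
    (hC : ∀ γ, 0 ≤ C γ) (hK : ∀ γ, 1 ≤ K γ)
    (hpar : ∀ γ x, |D (γ * x) - D x| ≤ C γ * √(D x))
    (hlow : ∀ γ x, D x ≤ K γ * D (γ * x))
    (hS : Summable fun x => (D x)⁻¹ * (D x)⁻¹) : False := by
  by_cases h1 : Summable fun x => (D x)⁻¹
  · have hb : ∀ γ : G, Summable fun x =>
        ‖((Real.log (D (γ⁻¹ * x)) : ℝ) : ℂ) - ((Real.log (D x) : ℝ) : ℂ)‖ ^ 2 := by
      intro γ
      refine Summable.of_nonneg_of_le (fun _ => by positivity) (fun x => ?_)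
        (h1.mul_left ((C γ⁻¹ * K γ⁻¹) ^ 2))
      rw [← Complex.ofReal_sub, Complex.norm_real, Real.norm_eq_abs, sq_abs]
      exact log_bound (hge _) (hge _) (hK _) (hC _) (hpar _ _) (hlow _ _)
    obtain ⟨k, hk⟩ := H.const (fun x => ((Real.log (D x) : ℝ) : ℂ)) hb
    have ht := (tendsto_of_summable_sq hk).norm
    have h2 := (tendsto_norm_atTop_atTop.comp (Real.tendsto_log_atTop.comp hD))
    refine not_tendsto_nhds_of_tendsto_atTop h2 _ (ht.congr fun x => ?_)
    simp only [Complex.norm_real, Function.comp]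
  · have hb : ∀ γ : G, Summable fun x =>
        ‖(((√(D (γ⁻¹ * x)))⁻¹ : ℝ) : ℂ) - (((√(D x))⁻¹ : ℝ) : ℂ)‖ ^ 2 := by
      intro γ
      refine Summable.of_nonneg_of_le (fun _ => by positivity) (fun x => ?_)
        (hS.mul_left (C γ⁻¹ ^ 2 * K γ⁻¹))
      rw [← Complex.ofReal_sub, Complex.norm_real, Real.norm_eq_abs, sq_abs]
      exact invsqrt_bound (hge _) (hge _) (hpar _ _) (hlow _ _)
    obtain ⟨k, hk⟩ := H.const (fun x => (((√(D x))⁻¹ : ℝ) : ℂ)) hb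
    have ht := (tendsto_of_summable_sq hk)
    have h2 := (Complex.continuous_ofReal.tendsto 0).comp
      ((Real.tendsto_sqrt_atTop.comp hD).inv_tendsto_atTop)
    have h3 : k = ((0 : ℝ) : ℂ) := tendsto_nhds_unique ht h2
    apply h1
    refine hk.congr fun x => ?_
    rw [h3, ← Complex.ofReal_sub, Complex.norm_real, Real.norm_eq_abs, sq_abs, sub_zero, inv_pow,
      Real.sq_sqrt (by linarith [hge x])]

theorem not_summable_two (Λ : Subgroup ↥(lorentzGroup n 𝕜)) (H : HOneVanish ↥Λ)
    [Infinite ↥Λ] :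
    ¬ Summable fun γ : ↥Λ => Dent (γ : ↥(lorentzGroup n 𝕜)) ^ (-(2 : ℝ)) := by
  intro hS
  obtain ⟨hD, c, hcl, hc, hfix⟩ := limit_data Λ H hS
  refine abstract_parabolic H (fun x : ↥Λ => Dent (x : ↥(lorentzGroup n 𝕜)))
    (fun γ => (n + 1) * Dent (γ : ↥(lorentzGroup n 𝕜)) * √2)
    (fun γ => (n + 1) * Dent (γ : ↥(lorentzGroup n 𝕜))) (fun x => Dent_ge _) hD ?_ ?_ ?_ ?_ ?_
  · intro γ
    have := Dent_ge (γ : ↥(lorentzGroup n 𝕜))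
    positivity
  · intro γ
    have := Dent_ge (γ : ↥(lorentzGroup n 𝕜))
    have h2 : (0 : ℝ) ≤ n := by positivity
    nlinarith
  · intro γ x
    have h1 := (hfix γ).2
    have h2 := (hfix x⁻¹).2
    rw [Subgroup.coe_inv] at h2
    have h3 := Dent_parabolic (γ : ↥(lorentzGroup n 𝕜)) (x : ↥(lorentzGroup n 𝕜)) c hcl hc h1 h2
    rw [← Subgroup.coe_mul] at h3
    exact h3
  · intro γ x
    have h3 := Dent_lower (γ : ↥(lorentzGroup n 𝕜)) (x : ↥(lorentzGroup n 𝕜))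
    rw [← Subgroup.coe_mul] at h3
    exact h3
  · exact hS.congr fun x => rpow_neg_two (Dent_ge _)

end parabolic
section counting
open Filter Topology
variable {n : ℕ} {𝕜 : Type*} [RCLike 𝕜]

lemma Bf_col_gen (g : ↥(lorentzGroup n 𝕜)) (j : Fin n) :
    ∑ i : Fin n, ‖lmt g i.castSucc j.castSucc‖ ^ 2 = 1 + ‖lmt g (Fin.last n) j.castSucc‖ ^ 2 := by
  have h := Bf_mulVec g (Pi.single j.castSucc 1) (Pi.single j.castSucc 1)
  have h2 := congrArg RCLike.re h
  rw [Bf_self, Bf_self] at h2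
  simp only [Matrix.mulVec_single_one, Matrix.col_apply] at h2
  have h3 : ∑ i : Fin n, ‖(Pi.single j.castSucc 1 : Fin (n + 1) → 𝕜) i.castSucc‖ ^ 2 = 1 := by
    rw [Finset.sum_eq_single j]
    · simp
    · intro b _ hb
      rw [Pi.single_eq_of_ne]
      · simp
      · simpa using hb
    · simp
  rw [h3, Pi.single_eq_of_ne (Fin.castSucc_lt_last j).ne'] at h2
  simp at h2
  linarith

lemma norm_le_re_im (z : 𝕜) : ‖z‖ ≤ |RCLike.re z| + |RCLike.im z| := by
  have h : ‖z‖ ^ 2 = RCLike.re z * RCLike.re z + RCLike.im z * RCLike.im z :=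
    RCLike.norm_sq_eq_def
  refine abs_le_of_sq_le_sq' ?_ (by positivity) |>.2
  nlinarith [sq_abs (RCLike.re z), sq_abs (RCLike.im z), abs_nonneg (RCLike.re z),
    abs_nonneg (RCLike.im z), mul_nonneg (abs_nonneg (RCLike.re z)) (abs_nonneg (RCLike.im z))]

lemma ent_le (g : ↥(lorentzGroup n 𝕜)) (i j : Fin (n + 1)) : ‖lmt g i j‖ ≤ 2 * Dent g := by
  have h1 := Dent_ge g
  induction j using Fin.lastCases with
  | last => have := col_le g i; simp only [col] at this; linarith
  | cast j =>
    induction i using Fin.lastCases with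
    | last => have := row_le g j.castSucc; linarith
    | cast i =>
      have h := Bf_col_gen g j
      have h2 := Finset.single_le_sum (f := fun i : Fin n => ‖lmt g i.castSucc j.castSucc‖ ^ 2)
        (fun _ _ => by positivity) (Finset.mem_univ i)
      have h3 := row_le g j.castSucc
      have h4 : ‖lmt g (Fin.last n) j.castSucc‖ ^ 2 ≤ Dent g ^ 2 := by gcongr
      refine abs_le_of_sq_le_sq' (?_ : _ ≤ (2 * Dent g) ^ 2) (by linarith) |>.2
      nlinarith

attribute [local instance] Matrix.linftyOpNormedRing Matrix.linftyOpNormedAlgebra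

lemma opnorm_le (A : Matrix (Fin (n + 1)) (Fin (n + 1)) 𝕜) (r : ℝ) (hr : 0 ≤ r)
    (h : ∀ i j, ‖A i j‖ ≤ r) : ‖A‖ ≤ (n + 1) * r := by
  rw [Matrix.linfty_opNorm_def]
  lift r to NNReal using hr
  have : (Finset.univ.sup fun i => ∑ j, ‖A i j‖₊) ≤ (n + 1) * r := by
    refine Finset.sup_le fun i _ => ?_
    calc ∑ j, ‖A i j‖₊ ≤ ∑ j : Fin (n + 1), r := Finset.sum_le_sum fun j _ => h i j
      _ = _ := by simp
  exact_mod_cast this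

lemma exists_gap (Λ : Subgroup ↥(lorentzGroup n 𝕜)) (hdisc : DiscreteTopology ↥Λ) :
    ∃ ε > 0, ∀ x : ↥Λ, ‖lmt (x : ↥(lorentzGroup n 𝕜)) - 1‖ < ε → x = 1 := by
  have hemb : IsInducing fun x : ↥Λ => lmt (x : ↥(lorentzGroup n 𝕜)) := by
    have h1 : IsInducing (Units.val : (Matrix (Fin (n + 1)) (Fin (n + 1)) 𝕜)ˣ → _) :=
      haveI : CompleteSpace (Matrix (Fin (n + 1)) (Fin (n + 1)) 𝕜) :=
        FiniteDimensional.complete 𝕜 _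
      Units.isOpenEmbedding_val.isInducing
    exact (h1.comp IsInducing.subtypeVal).comp IsInducing.subtypeVal
  have h1 : ({1} : Set ↥Λ) ∈ 𝓝 (1 : ↥Λ) := (isOpen_discrete _).mem_nhds rfl
  rw [hemb.nhds_eq_comap, mem_comap] at h1
  obtain ⟨t, ht, hts⟩ := h1
  simp only [OneMemClass.coe_one, lmt_one] at ht
  obtain ⟨ε, hε, hb⟩ := Metric.mem_nhds_iff.1 ht
  refine ⟨ε, hε, fun x hx => hts (hb ?_)⟩
  simpa [dist_eq_norm] using hx

lemma exists_summable (Λ : Subgroup ↥(lorentzGroup n 𝕜)) (hdisc : DiscreteTopology ↥Λ) :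
    ∃ s : ℕ, Summable fun x : ↥Λ => ((Dent (x : ↥(lorentzGroup n 𝕜))) ^ s)⁻¹ := by
  obtain ⟨ε, hε, hgap⟩ := exists_gap Λ hdisc
  obtain ⟨T, hT⟩ := exists_nat_gt (4 * ((n : ℝ) + 1) ^ 2 / ε)
  have hT0 : (0 : ℝ) < T := lt_of_le_of_lt (by positivity) hT
  have hT1 : 1 ≤ T := by exact_mod_cast hT0
  let ι := (Fin (n + 1) × Fin (n + 1)) × Bool
  let N := Fintype.card ι
  let s := 2 * N + 2
  let B : ℕ → ℤ := fun m => 3 * T * m ^ 2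
  let box : ℕ → Finset (ι → ℤ) := fun m => Fintype.piFinset fun _ => Finset.Icc (-B m) (B m)
  let md : ↥Λ → ℕ := fun x => ⌈Dent (x : ↥(lorentzGroup n 𝕜))⌉₊
  let part : ↥Λ → ι → ℝ := fun x p => if p.2 then
    RCLike.re (lmt (x : ↥(lorentzGroup n 𝕜)) p.1.1 p.1.2) else
    RCLike.im (lmt (x : ↥(lorentzGroup n 𝕜)) p.1.1 p.1.2)
  have hge : ∀ x : ↥Λ, 1 ≤ Dent (x : ↥(lorentzGroup n 𝕜)) := fun x => Dent_ge _
  have hmd : ∀ x : ↥Λ, Dent (x : ↥(lorentzGroup n 𝕜)) ≤ md x := fun x => Nat.le_ceil _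
  have hmd1 : ∀ x : ↥Λ, (1 : ℝ) ≤ md x := fun x => (hge x).trans (hmd x)
  have hmd2 : ∀ x : ↥Λ, (md x : ℝ) ≤ 2 * Dent (x : ↥(lorentzGroup n 𝕜)) := by
    intro x
    have := Nat.ceil_lt_add_one (show 0 ≤ Dent (x : ↥(lorentzGroup n 𝕜)) by linarith [hge x])
    linarith [hge x]
  have hpart : ∀ x p, |part x p| ≤ 2 * md x := by
    intro x p
    have h1 := ent_le (x : ↥(lorentzGroup n 𝕜)) p.1.1 p.1.2
    have h2 := hmd x
    simp only [part]
    split_ifs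
    · linarith [RCLike.abs_re_le_norm (lmt (x : ↥(lorentzGroup n 𝕜)) p.1.1 p.1.2)]
    · linarith [RCLike.abs_im_le_norm (lmt (x : ↥(lorentzGroup n 𝕜)) p.1.1 p.1.2)]
  let fl : ↥Λ → ι → ℤ := fun x p => ⌊(T : ℝ) * md x * part x p⌋
  have hfl : ∀ x, fl x ∈ box (md x) := by
    intro x
    rw [Fintype.mem_piFinset]
    intro p
    have h1 := abs_le.1 (hpart x p)
    have h2 := hmd1 x
    have hTm : (1 : ℝ) ≤ T * md x := by
      have : (1 : ℝ) ≤ T := by exact_mod_cast hT1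
      nlinarith
    have h3 : (T : ℝ) * md x * part x p ≤ T * md x * (2 * md x) := by gcongr; exact h1.2
    have h4 : T * md x * (-(2 * md x)) ≤ (T : ℝ) * md x * part x p := by gcongr; exact h1.1
    have h5 := Int.floor_le ((T : ℝ) * md x * part x p)
    have h6 := Int.lt_floor_add_one ((T : ℝ) * md x * part x p)
    have h7 : (1 : ℝ) ≤ T * md x * md x := by nlinarith
    rw [Finset.mem_Icc]
    constructor
    · have : (-(B (md x)) : ℝ) ≤ (fl x p : ℝ) := by
        simp only [B, fl]; push_cast; nlinarith
      exact_mod_cast this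
    · have : (fl x p : ℝ) ≤ (B (md x) : ℝ) := by
        simp only [B, fl]; push_cast; nlinarith
      exact_mod_cast this
  let Φ : ↥Λ → Σ m : ℕ, ↥(box m) := fun x => ⟨md x, ⟨fl x, hfl x⟩⟩
  have hΦ : Function.Injective Φ := by
    intro x y hxy
    have hm : md x = md y := congrArg Sigma.fst hxy
    have hf : fl x = fl y := congrArg (fun q : Σ m : ℕ, ↥(box m) => (q.2 : ι → ℤ)) hxy
    have hm0 : (0 : ℝ) < md x := by linarith [hmd1 x]
    have hp : ∀ p, |part y p - part x p| ≤ 1 / (T * md x) := by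
      intro p
      have h1 := Int.abs_sub_lt_one_of_floor_eq_floor (congrFun hf p).symm
      rw [← hm, ← mul_sub, abs_mul, abs_of_pos (by positivity)] at h1
      rw [le_div_iff₀ (by positivity)]
      linarith
    have hent : ∀ i j, ‖(lmt (y : ↥(lorentzGroup n 𝕜)) - lmt (x : ↥(lorentzGroup n 𝕜))) i j‖ ≤
        2 / (T * md x) := by
      intro i j
      have h1 := hp ((i, j), true)
      have h2 := hp ((i, j), false)
      simp only [part, if_true, Bool.false_eq_true, if_false, ← map_sub] at h1 h2
      rw [Matrix.sub_apply]
      refine (norm_le_re_im _).trans ?_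
      have : 2 / (T * (md x : ℝ)) = 1 / (T * md x) + 1 / (T * md x) := by ring
      linarith
    have hn1 := opnorm_le _ _ (by positivity) hent
    have hn2 : ‖lmt ((x : ↥(lorentzGroup n 𝕜))⁻¹)‖ ≤ (n + 1) * (2 * md x) := by
      refine opnorm_le _ _ (by positivity) fun i j => ?_
      have := ent_le ((x : ↥(lorentzGroup n 𝕜))⁻¹) i j
      rw [Dent_inv] at this
      linarith [hmd x]
    have key : x⁻¹ * y = 1 := by
      apply hgap
      have e : lmt ((x⁻¹ * y : ↥Λ) : ↥(lorentzGroup n 𝕜)) - 1 =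
          lmt ((x : ↥(lorentzGroup n 𝕜))⁻¹) *
            (lmt (y : ↥(lorentzGroup n 𝕜)) - lmt (x : ↥(lorentzGroup n 𝕜))) := by
        rw [mul_sub, ← lmt_mul, ← lmt_mul, inv_mul_cancel, lmt_one]
        rfl
      rw [e]
      calc _ ≤ ‖lmt ((x : ↥(lorentzGroup n 𝕜))⁻¹)‖ *
            ‖lmt (y : ↥(lorentzGroup n 𝕜)) - lmt (x : ↥(lorentzGroup n 𝕜))‖ := norm_mul_le _ _
        _ ≤ ((n + 1) * (2 * md x)) * ((n + 1) * (2 / (T * md x))) := by gcongr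
        _ = 4 * ((n : ℝ) + 1) ^ 2 / T := by field_simp; ring
        _ < ε := by
          rw [div_lt_iff₀ hε] at hT
          rw [div_lt_iff₀ hT0]
          linarith
    exact (inv_mul_eq_one.1 key)
  let F : (Σ m : ℕ, ↥(box m)) → ℝ := fun q => 2 ^ s * ((q.1 : ℝ) ^ s)⁻¹
  have hF : Summable F := by
    rw [summable_sigma_of_nonneg (fun q => by simp only [F]; positivity)]
    refine ⟨fun m => Summable.of_finite, ?_⟩
    have hcard : ∀ m : ℕ, ((box m).card : ℝ) = (6 * T * m ^ 2 + 1) ^ N := by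
      intro m
      have : (box m).card = (6 * T * m ^ 2 + 1) ^ N := by
        simp only [box, Fintype.card_piFinset, Int.card_Icc, Finset.prod_const, Finset.card_univ]
        congr 1
        simp only [B]
        have : (3 * T * m ^ 2 + 1 - -(3 * T * m ^ 2) : ℤ) = ((6 * T * m ^ 2 + 1 : ℕ) : ℤ) := by
          push_cast; ring
        rw [this, Int.toNat_natCast]
      rw [this]
      push_cast
      rfl
    have hsum : Summable fun m : ℕ => (2 ^ s * (7 * T : ℝ) ^ N) * ((m : ℝ) ^ 2)⁻¹ :=
      (Real.summable_nat_pow_inv.2 (by norm_num)).mul_left _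
    refine Summable.of_nonneg_of_le (fun m => tsum_nonneg fun _ => by simp only [F]; positivity)
      (fun m => ?_) hsum
    rw [tsum_fintype]
    simp only [F, Finset.sum_const, Finset.card_univ, Fintype.card_coe, nsmul_eq_mul]
    rw [hcard]
    rcases Nat.eq_zero_or_pos m with rfl | hm
    · simp [s]
    · have hm1 : (1 : ℝ) ≤ m := by exact_mod_cast hm
      have hT1' : (1 : ℝ) ≤ T := by exact_mod_cast hT1
      have h1 : (6 * T * (m : ℝ) ^ 2 + 1) ≤ 7 * T * m ^ 2 := by
        have : (1 : ℝ) ≤ (m : ℝ) ^ 2 := one_le_pow₀ hm1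
        nlinarith
      calc (6 * T * (m : ℝ) ^ 2 + 1) ^ N * (2 ^ s * ((m : ℝ) ^ s)⁻¹)
          ≤ (7 * T * m ^ 2) ^ N * (2 ^ s * ((m : ℝ) ^ s)⁻¹) := by gcongr
        _ = _ := by
          simp only [s]
          rw [mul_pow, ← pow_mul, pow_add (m : ℝ), mul_inv]
          field_simp
  refine ⟨s, Summable.of_nonneg_of_le (fun x => ?_) (fun x => ?_) (hF.comp_injective hΦ)⟩
  · have := hge x
    positivity
  · simp only [Function.comp, F, Φ]
    have h0 := hmd1 x
    have h1 := hge x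
    rw [← div_eq_mul_inv, ← div_pow, ← inv_pow]
    apply pow_le_pow_left₀ (by positivity)
    rw [inv_le_iff_one_le_mul₀ (by linarith), div_mul_eq_mul_div, le_div_iff₀ (by linarith)]
    linarith [hmd2 x]

end counting

/-- **Theorem 1.5.** If `Λ` is an infinite finitely generated discrete subgroup of
`SO(n,1)` or `SU(n,1)` all of whose cocycles with values in its regular representation
`ℓ²(Λ)` are coboundaries, then its Poincaré series diverges at `s = 2`; in particular
`δ(Λ) ≥ 2`, and in case of equality `Λ` is of divergence type. -/
theorem poincare_series_diverges_at_two_of_H1_regular_vanishes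
    {𝕜 : Type*} [RCLike 𝕜] {n : ℕ} (hn : 2 ≤ n)
    (Λ : Subgroup ↥(lorentzGroup n 𝕜)) (hdisc : DiscreteTopology ↥Λ)
    (hinf : Infinite ↥Λ) (hfg : Group.FG ↥Λ)
    (hH1 : ∀ b : ↥Λ → lp (fun _ : ↥Λ => ℂ) 2,
      (∀ γ η x : ↥Λ, (b (γ * η) : ∀ _ : ↥Λ, ℂ) x
          = (b γ : ∀ _ : ↥Λ, ℂ) x + (b η : ∀ _ : ↥Λ, ℂ) (γ⁻¹ * x)) →
      ∃ f : lp (fun _ : ↥Λ => ℂ) 2, ∀ γ x : ↥Λ,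
        (b γ : ∀ _ : ↥Λ, ℂ) x = (f : ∀ _ : ↥Λ, ℂ) (γ⁻¹ * x) - (f : ∀ _ : ↥Λ, ℂ) x) :
    (¬ Summable fun γ : ↥Λ => Dent (γ : ↥(lorentzGroup n 𝕜)) ^ (-(2 : ℝ))) ∧
      2 ≤ critExp Λ := by
  have hne := hinf
  have h1 := not_summable_two Λ hH1
  refine ⟨h1, ?_⟩
  obtain ⟨s, hs⟩ := exists_summable Λ hdisc
  refine le_csInf ⟨(s : ℝ), by positivity, ?_⟩ ?_
  · refine hs.congr fun x => ?_
    have := Dent_ge (x : ↥(lorentzGroup n 𝕜))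
    rw [Real.rpow_neg (by linarith), Real.rpow_natCast]
  · rintro r ⟨_, hr⟩
    by_contra! hlt
    apply h1
    refine Summable.of_nonneg_of_le (fun x => ?_) (fun x => ?_) hr
    · have := Dent_ge (x : ↥(lorentzGroup n 𝕜))
      positivity
    · exact Real.rpow_le_rpow_of_exponent_le (Dent_ge _) (by linarith)

end
end

section
/- Let G be a group, K ≤ G a subgroup, and (σ, H) a unitary representation of G on a complex Hilbert space (no continuity assumed). Suppose v ∈ H is a unit vector such that the subspace of K-fixed vectors {w ∈ H : σ(k)w = w for all k ∈ K} equals the complex line ℂ·v, and the linear span of {σ(g)v : g ∈ G} is dense in H. Then σ is irreducible: every closed G-invariant subspace of H is {0} or H. -/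
noncomputable section
/-- The subspace of `K`-fixed vectors of a unitary representation. -/
def fixedSubmodule {G : Type*} [Group G] {H : Type*} [NormedAddCommGroup H]
    [InnerProductSpace ℂ H] (σ : G →* (H ≃ₗᵢ[ℂ] H)) (K : Subgroup G) :
    Submodule ℂ H where
  carrier := {w | ∀ k : K, σ (k : G) w = w}
  add_mem' := by
    intro a b ha hb k
    simp [map_add, ha k, hb k]
  zero_mem' := by
    intro k
    simp
  smul_mem' := by
    intro c w hw k
    simp [_root_.map_smul, hw k]


/-- (From the proof of Proposition 2.6.) A unitary representation with a cyclic vector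
spanning the one-dimensional space of `K`-fixed vectors is irreducible. -/
theorem irreducible_of_cyclic_K_fixed_vector
    {G : Type*} [Group G] (K : Subgroup G)
    {H : Type*} [NormedAddCommGroup H] [InnerProductSpace ℂ H] [CompleteSpace H]
    (σ : G →* (H ≃ₗᵢ[ℂ] H)) (v : H) (hv : ‖v‖ = 1)
    (hfix : fixedSubmodule σ K = Submodule.span ℂ {v})
    (hdense : Dense ((Submodule.span ℂ (Set.range fun g : G => σ g v) : Submodule ℂ H) : Set H)) :
    ∀ W : Submodule ℂ H, IsClosed (W : Set H) → (∀ g : G, ∀ w ∈ W, σ g w ∈ W) →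
      W = ⊥ ∨ W = ⊤ := by
  intro W hW hinv
  have : CompleteSpace W := hW.completeSpace_coe
  have hinvo : ∀ g : G, ∀ w ∈ Wᗮ, σ g w ∈ Wᗮ := by
    intro g w hw
    rw [Submodule.mem_orthogonal] at hw ⊢
    intro u hu
    have h1 := hw _ (hinv g⁻¹ u hu)
    rw [← (σ g).inner_map_map] at h1
    have h2 : σ g (σ g⁻¹ u) = u := by
      have h3 : (σ g * σ g⁻¹) u = u := by
        rw [← map_mul]
        simp
      exact h3
    rwa [h2] at h1
  have key : ∀ U : Submodule ℂ H, IsClosed (U : Set H) → (∀ g : G, ∀ w ∈ U, σ g w ∈ U) →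
      v ∈ U → U = ⊤ := by
    intro U hU hUi hvU
    have hle : Submodule.span ℂ (Set.range fun g : G => σ g v) ≤ U := by
      rw [Submodule.span_le]
      rintro _ ⟨g, rfl⟩
      exact hUi g v hvU
    have hd : Dense (U : Set H) := hdense.mono hle
    rw [← SetLike.coe_set_eq, ← hU.closure_eq, hd.closure_eq]
    rfl
  have hvfix : v ∈ fixedSubmodule σ K := by
    rw [hfix]
    exact Submodule.mem_span_singleton_self v
  have hp : W.starProjection v ∈ fixedSubmodule σ K := by
    intro k
    symm
    apply Submodule.eq_starProjection_of_mem_orthogonal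
    · exact hinv _ _ (W.starProjection_apply_mem v)
    · have h1 := hinvo k _ (W.sub_starProjection_mem_orthogonal v)
      rwa [map_sub, hvfix k] at h1
  rw [hfix, Submodule.mem_span_singleton] at hp
  obtain ⟨c, hc⟩ := hp
  by_cases h0 : c = 0
  · left
    have h1 := W.sub_starProjection_mem_orthogonal v
    rw [← hc, h0, zero_smul, sub_zero] at h1
    have h2 := key _ W.isClosed_orthogonal hinvo h1
    rwa [Submodule.orthogonal_eq_top_iff] at h2
  · right
    apply key W hW hinv
    have h1 := W.starProjection_apply_mem v
    rw [← hc] at h1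
    exact (W.smul_mem_iff h0).1 h1

end
end
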